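/- arXiv:2507.09151 — 3 statements merged into one kernel-verified Lean document; each statement's English description precedes it below -/
import Mathlib

section
/- Chain rule (disintegration) for KL divergence with two coordinates: if P and Q are probability measures on a product space X × Y with P ≪ Q, then KL(P‖Q) = KL(P_X‖Q_X) + E_{x∼P_X}[KL(P(·|x) ‖ Q(·|x))], where P_X, Q_X are the first marginals and P(·|x), Q(·|x) are conditional (disintegration) kernels. -/
open MeasureTheory ProbabilityTheory

/-- The density of `μ ⊗ₘ κ` with respect to `μ ⊗ₘ η` is the kernel density. -/
lemma rnDeriv_compProd_right_aux {X Y : Type*} [MeasurableSpace X]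
    [MeasurableSpace Y] [MeasurableSpace.CountableOrCountablyGenerated X Y]
    (μ : Measure X) [IsFiniteMeasure μ]
    (κ η : Kernel X Y) [IsFiniteKernel κ] [IsFiniteKernel η]
    (hac : ∀ᵐ x ∂μ, κ x ≪ η x) :
    (μ ⊗ₘ κ).rnDeriv (μ ⊗ₘ η) =ᵐ[μ ⊗ₘ η] fun p => Kernel.rnDeriv κ η p.1 p.2 := by
  have hm : Measurable (fun p : X × Y => Kernel.rnDeriv κ η p.1 p.2) :=
    Kernel.measurable_rnDeriv κ η
  have h : μ ⊗ₘ κ = (μ ⊗ₘ η).withDensity (fun p => Kernel.rnDeriv κ η p.1 p.2) := by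
    ext s hs
    rw [withDensity_apply _ hs, Measure.compProd_apply hs, ← lintegral_indicator hs,
      Measure.lintegral_compProd (hm.indicator hs)]
    refine lintegral_congr_ae ?_
    filter_upwards [hac] with x hx
    have hs' : MeasurableSet (Prod.mk x ⁻¹' s) := measurable_prodMk_left hs
    rw [← Kernel.setLIntegral_rnDeriv hx hs', ← lintegral_indicator hs']
    rfl
  conv_lhs => rw [h]
  exact Measure.rnDeriv_withDensity _ hm

theorem kl_chain_rule {X Y : Type*} [MeasurableSpace X] [StandardBorelSpace X] [Nonempty X]
    [MeasurableSpace Y] [StandardBorelSpace Y] [Nonempty Y]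
    (P Q : Measure (X × Y)) [IsProbabilityMeasure P] [IsProbabilityMeasure Q]
    (hPQ : P ≪ Q)
    (hint : Integrable (fun z => Real.log (P.rnDeriv Q z).toReal) P) :
    ∫ z, Real.log (P.rnDeriv Q z).toReal ∂P
      = (∫ x, Real.log (P.fst.rnDeriv Q.fst x).toReal ∂P.fst)
        + ∫ x, (∫ y, Real.log ((P.condKernel x).rnDeriv (Q.condKernel x) y).toReal
            ∂(P.condKernel x)) ∂P.fst := by
  have hP : P.fst ⊗ₘ P.condKernel = P := P.disintegrate P.condKernel
  have hQ : Q.fst ⊗ₘ Q.condKernel = Q := Q.disintegrate Q.condKernel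
  have h_ac : P.fst ⊗ₘ P.condKernel ≪ Q.fst ⊗ₘ Q.condKernel := by rwa [hP, hQ]
  have h_int : Integrable (llr (P.fst ⊗ₘ P.condKernel) (Q.fst ⊗ₘ Q.condKernel))
      (P.fst ⊗ₘ P.condKernel) := by rw [hP, hQ]; exact hint
  have hker := h_ac.kernel_of_compProd
  have hint2 := ((InformationTheory.integrable_llr_compProd_iff h_ac).mp h_int).2
  have h_ac2 : P.fst ⊗ₘ P.condKernel ≪ P.fst ⊗ₘ Q.condKernel :=
    (Measure.absolutelyContinuous_compProd_iff.mp h_ac).2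
  have key := InformationTheory.integral_llr_compProd_eq_add h_ac h_int
  rw [Measure.integral_compProd hint2] at key
  have hrn := Measure.ae_ae_of_ae_compProd
    (h_ac2.ae_le (rnDeriv_compProd_right_aux P.fst P.condKernel Q.condKernel hker))
  have hlast : ∫ x, (∫ y, llr (P.fst ⊗ₘ P.condKernel) (P.fst ⊗ₘ Q.condKernel) (x, y)
      ∂(P.condKernel x)) ∂P.fst
      = ∫ x, (∫ y, Real.log ((P.condKernel x).rnDeriv (Q.condKernel x) y).toReal
            ∂(P.condKernel x)) ∂P.fst := by
    refine integral_congr_ae ?_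
    filter_upwards [hrn, hker] with x hx hxac
    refine integral_congr_ae ?_
    filter_upwards [hx, hxac.ae_le (Kernel.rnDeriv_eq_rnDeriv_measure
      (κ := P.condKernel) (η := Q.condKernel) (a := x))] with y hy hy2
    simp only [llr]
    rw [hy, hy2]
  rw [hlast, hP, hQ] at key
  exact key
end

section
/- Markov telescoping of KL divergence: let P and Q be probability measures on X₀ × X₁ × ⋯ × X_m such that Q factors as a Markov chain, Q(dx₀,…,dx_m) = Q₀₁(dx₀,dx₁) ∏_{j=2}^m Q_{j|j−1}(dx_j|x_{j−1}), and P is also Markov. If moreover P and Q have equal one-dimensional marginals at each coordinate j = 1, …, m−1, then KL(P‖Q) = Σ_{j=1}^m KL(P_{j−1,j} ‖ Q_{j−1,j}), where P_{j−1,j} and Q_{j−1,j} denote the joint marginals on coordinates (j−1, j). -/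
open MeasureTheory ProbabilityTheory

/-- The Kullback–Leibler divergence `KL(P‖Q) = ∫ log (dP/dQ) dP`. -/
noncomputable def KL {Ω : Type*} [MeasurableSpace Ω] (P Q : Measure Ω) : ℝ :=
  ∫ ω, Real.log (P.rnDeriv Q ω).toReal ∂P

/-- A probability measure on a finite product `Fin (m+1) → X` is Markov (with respect to the
coordinate ordering) if, for every `j`, the past `σ(coords ≤ j)` and the future
`σ(coords ≥ j)` are conditionally independent given the present coordinate `j`. -/
def IsMarkov {X : Type*} [mX : MeasurableSpace X] [StandardBorelSpace X] [Nonempty X] {m : ℕ}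
    (P : Measure (Fin (m + 1) → X)) [IsFiniteMeasure P] : Prop :=
  ∀ j : Fin (m + 1),
    CondIndep (MeasurableSpace.comap (fun ω => ω j) mX)
      (⨆ i ∈ {i : Fin (m + 1) | i ≤ j}, MeasurableSpace.comap (fun ω => ω i) mX)
      (⨆ i ∈ {i : Fin (m + 1) | j ≤ i}, MeasurableSpace.comap (fun ω => ω i) mX)
      (measurable_iff_comap_le.mp (measurable_pi_apply j)) P

open InformationTheory in
lemma kl_eq_toReal {Ω : Type*} [MeasurableSpace Ω] (P Q : Measure Ω) [IsProbabilityMeasure P]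
    [IsProbabilityMeasure Q] (h : P ≪ Q) : KL P Q = (klDiv P Q).toReal := by
  rw [toReal_klDiv_of_measure_eq h (by simp)]
  rfl

/-- If two maps factor through one another, the divergences of the images agree. -/
lemma klDiv_map_eq {Ω α β : Type*} [MeasurableSpace Ω] [MeasurableSpace α] [MeasurableSpace β]
    (P Q : Measure Ω) [IsFiniteMeasure P] [IsFiniteMeasure Q]
    {f : Ω → α} {g : Ω → β} (hf : Measurable f) (hg : Measurable g)
    (u : α → β) (v : β → α) (hu : Measurable u) (hv : Measurable v)
    (huf : ∀ ω, u (f ω) = g ω) (hvg : ∀ ω, v (g ω) = f ω) :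
    InformationTheory.klDiv (P.map f) (Q.map f) = InformationTheory.klDiv (P.map g) (Q.map g) := by
  have h1 : u ∘ f = g := funext huf
  have h2 : v ∘ g = f := funext hvg
  apply le_antisymm
  · have := InformationTheory.klDiv_map_le (P.map g) (Q.map g) hv
    rwa [Measure.map_map hv hg, Measure.map_map hv hg, h2] at this
  · have := InformationTheory.klDiv_map_le (P.map f) (Q.map f) hu
    rwa [Measure.map_map hu hf, Measure.map_map hu hf, h1] at this

lemma compProd_swap_aux {γ α β : Type*} [MeasurableSpace γ] [MeasurableSpace α]
    [MeasurableSpace β] (μ : Measure γ) [IsFiniteMeasure μ] (κ : Kernel γ α) (η : Kernel γ β)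
    [IsMarkovKernel κ] [IsMarkovKernel η] :
    ((μ ⊗ₘ κ) ⊗ₘ η.prodMkRight α).map (fun p => ((p.1.1, p.2), p.1.2)) =
      (μ ⊗ₘ η) ⊗ₘ κ.prodMkRight β := by
  ext s hs
  have hm : Measurable (fun p : (γ × α) × β => ((p.1.1, p.2), p.1.2)) := by fun_prop
  rw [← lintegral_indicator_one hs, ← lintegral_indicator_one hs, lintegral_map (by fun_prop (disch := assumption)) hm,
    Measure.lintegral_compProd (by fun_prop (disch := assumption)), Measure.lintegral_compProd (by fun_prop (disch := assumption)),
    Measure.lintegral_compProd (by fun_prop (disch := assumption)), Measure.lintegral_compProd (by fun_prop (disch := assumption))]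
  refine lintegral_congr fun b => ?_
  simp only [Kernel.prodMkRight_apply]
  rw [lintegral_lintegral_swap]
  fun_prop (disch := assumption)

lemma klDiv_cond_aux {γ α β : Type*} [MeasurableSpace γ] [MeasurableSpace α]
    [MeasurableSpace β] (μ : Measure γ) [IsFiniteMeasure μ] (κ : Kernel γ α) (η η' : Kernel γ β)
    [IsMarkovKernel κ] [IsMarkovKernel η] [IsMarkovKernel η'] :
    InformationTheory.klDiv ((μ ⊗ₘ κ) ⊗ₘ η.prodMkRight α) ((μ ⊗ₘ κ) ⊗ₘ η'.prodMkRight α) =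
      InformationTheory.klDiv (μ ⊗ₘ η) (μ ⊗ₘ η') := by
  have h := klDiv_map_eq ((μ ⊗ₘ κ) ⊗ₘ η.prodMkRight α) ((μ ⊗ₘ κ) ⊗ₘ η'.prodMkRight α)
    (f := id) (g := fun p => ((p.1.1, p.2), p.1.2)) measurable_id (by fun_prop)
    (fun p => ((p.1.1, p.2), p.1.2)) (fun p => ((p.1.1, p.2), p.1.2))
    (by fun_prop) (by fun_prop) (fun _ => rfl) (fun _ => rfl)
  rw [Measure.map_id, Measure.map_id, compProd_swap_aux, compProd_swap_aux,
    InformationTheory.klDiv_compProd_left] at h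
  exact h

lemma map_factor {Ω γ α β : Type*} [MeasurableSpace Ω] [StandardBorelSpace Ω]
    [MeasurableSpace γ] [MeasurableSpace α] [MeasurableSpace β]
    [StandardBorelSpace α] [Nonempty α] [StandardBorelSpace β] [Nonempty β]
    (P : Measure Ω) [IsProbabilityMeasure P] {A : Ω → α} {B : Ω → γ} {C : Ω → β}
    (hA : Measurable A) (hB : Measurable B) (hC : Measurable C)
    (h : CondIndepFun (MeasurableSpace.comap B inferInstance) hB.comap_le A C P) :
    P.map (fun ω => ((B ω, A ω), C ω)) =
      ((P.map B) ⊗ₘ condDistrib A B P) ⊗ₘ (condDistrib C B P).prodMkRight α := by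
  have h' := (condIndepFun_iff_condDistrib_prod_ae_eq_prodMkRight hC hA hB).mp h
  rw [compProd_map_condDistrib hA.aemeasurable]
  exact (condDistrib_ae_eq_iff_measure_eq_compProd _ hC.aemeasurable _).mp h'

lemma klDiv_step {Ω γ α β : Type*} [MeasurableSpace Ω] [StandardBorelSpace Ω]
    [MeasurableSpace γ] [MeasurableSpace α] [MeasurableSpace β]
    [StandardBorelSpace α] [Nonempty α] [StandardBorelSpace β] [Nonempty β]
    (P Q : Measure Ω) [IsProbabilityMeasure P] [IsProbabilityMeasure Q]
    {A : Ω → α} {B : Ω → γ} {C : Ω → β}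
    (hA : Measurable A) (hB : Measurable B) (hC : Measurable C)
    (hP : CondIndepFun (MeasurableSpace.comap B inferInstance) hB.comap_le A C P)
    (hQ : CondIndepFun (MeasurableSpace.comap B inferInstance) hB.comap_le A C Q)
    (hPQ : P.map B = Q.map B) :
    InformationTheory.klDiv (P.map (fun ω => ((B ω, A ω), C ω)))
        (Q.map (fun ω => ((B ω, A ω), C ω))) =
      InformationTheory.klDiv (P.map (fun ω => (B ω, A ω))) (Q.map (fun ω => (B ω, A ω))) +
      InformationTheory.klDiv (P.map (fun ω => (B ω, C ω))) (Q.map (fun ω => (B ω, C ω))) := by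
  have : IsProbabilityMeasure (P.map B) := Measure.isProbabilityMeasure_map hB.aemeasurable
  have : IsProbabilityMeasure (Q.map B) := Measure.isProbabilityMeasure_map hB.aemeasurable
  rw [map_factor P hA hB hC hP, map_factor Q hA hB hC hQ,
    InformationTheory.klDiv_compProd_eq_add, klDiv_cond_aux,
    compProd_map_condDistrib hA.aemeasurable, compProd_map_condDistrib hA.aemeasurable,
    compProd_map_condDistrib hC.aemeasurable, hPQ, compProd_map_condDistrib hC.aemeasurable]

/-- The path stopped at time `k`. -/
def stopAt {X : Type*} {m : ℕ} (k : ℕ) (ω : Fin (m + 1) → X) : Fin (m + 1) → X :=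
  fun i => ω ⟨min i k, by omega⟩

lemma measurable_stopAt {X : Type*} [MeasurableSpace X] {m : ℕ} (k : ℕ) :
    Measurable (stopAt k : (Fin (m + 1) → X) → Fin (m + 1) → X) :=
  measurable_pi_lambda _ fun _ => measurable_pi_apply _

lemma condIndepFun_stopAt {X : Type*} [mX : MeasurableSpace X] [StandardBorelSpace X] [Nonempty X]
    {m : ℕ} (P : Measure (Fin (m + 1) → X)) [IsProbabilityMeasure P] (hP : IsMarkov P)
    (j : Fin m) :
    CondIndepFun (MeasurableSpace.comap (fun ω : Fin (m + 1) → X => ω j.castSucc) mX)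
      (measurable_pi_apply j.castSucc).comap_le
      (stopAt (j : ℕ)) (fun ω => ω j.succ) P := by
  rw [condIndepFun_iff_condIndep]
  refine condIndep_of_condIndep_of_le_left (condIndep_of_condIndep_of_le_right
    (hP j.castSucc) ?_) ?_
  · exact le_iSup₂_of_le (f := fun (i : Fin (m + 1)) (_ : i ∈ {i : Fin (m + 1) | j.castSucc ≤ i}) =>
      MeasurableSpace.comap (fun ω : Fin (m + 1) → X => ω i) mX) j.succ
      (Fin.castSucc_lt_succ).le le_rfl
  · rw [← measurable_iff_comap_le]
    refine @measurable_pi_lambda _ _ _ (_) _ _ fun i => ?_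
    rw [measurable_iff_comap_le]
    refine le_iSup₂_of_le (f := fun (i : Fin (m + 1)) (_ : i ∈ {i : Fin (m + 1) | i ≤ j.castSucc}) =>
      MeasurableSpace.comap (fun ω : Fin (m + 1) → X => ω i) mX) ⟨min i j, by omega⟩ ?_ le_rfl
    simp [Fin.le_def]

open InformationTheory in
lemma klDiv_stopAt {X : Type*} [MeasurableSpace X] [StandardBorelSpace X]
    [Nonempty X] {m : ℕ}
    (P Q : Measure (Fin (m + 1) → X)) [IsProbabilityMeasure P] [IsProbabilityMeasure Q]
    (hP : IsMarkov P) (hQ : IsMarkov Q)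
    (hmarg : ∀ j : Fin (m + 1), 0 < (j : ℕ) → (j : ℕ) < m →
      P.map (fun ω => ω j) = Q.map (fun ω => ω j)) (k : ℕ) (hk : k < m) :
    klDiv (P.map (stopAt (k + 1))) (Q.map (stopAt (k + 1))) =
      ∑ j ∈ Finset.range (k + 1), if h : j < m then
        klDiv (P.map fun ω => (ω (Fin.castSucc ⟨j, h⟩), ω (Fin.succ ⟨j, h⟩)))
          (Q.map fun ω => (ω (Fin.castSucc ⟨j, h⟩), ω (Fin.succ ⟨j, h⟩))) else 0 := by
  induction k with
  | zero =>
    simp only [zero_add, Finset.sum_range_one, hk, dif_pos]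
    refine klDiv_map_eq P Q (measurable_stopAt _) (by fun_prop)
      (fun ω => (ω (Fin.castSucc ⟨0, hk⟩), ω (Fin.succ ⟨0, hk⟩)))
      (fun z i => if (i : ℕ) = 0 then z.1 else z.2) (by fun_prop) ?_ ?_ ?_
    · refine measurable_pi_lambda _ fun i => ?_
      split_ifs <;> fun_prop
    · intro ω
      simp only [stopAt]
      congr 2
    · intro ω
      funext i
      simp only [stopAt]
      split_ifs with h
      · congr 1
        ext
        simp [h]
      · congr 1
        ext
        simp
        omega
  | succ k ih =>
    rw [Finset.sum_range_succ, ← ih (by omega), dif_pos hk]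
    have hstep := klDiv_step P Q (measurable_stopAt (k + 1))
      (measurable_pi_apply (Fin.castSucc ⟨k + 1, hk⟩)) (measurable_pi_apply (Fin.succ ⟨k + 1, hk⟩))
      (condIndepFun_stopAt P hP ⟨k + 1, hk⟩) (condIndepFun_stopAt Q hQ ⟨k + 1, hk⟩)
      (hmarg _ (by simp) (by simpa using hk))
    have e1 : klDiv (P.map (stopAt (k + 1))) (Q.map (stopAt (k + 1))) =
        klDiv (P.map fun ω => (ω (Fin.castSucc ⟨k + 1, hk⟩), stopAt (k + 1) ω))
        (Q.map fun ω => (ω (Fin.castSucc ⟨k + 1, hk⟩), stopAt (k + 1) ω)) := by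
      refine klDiv_map_eq P Q (measurable_stopAt _)
        ((measurable_pi_apply _).prodMk (measurable_stopAt _))
        (fun ω => (ω (Fin.castSucc ⟨k + 1, hk⟩), ω)) Prod.snd (by fun_prop) (by fun_prop) ?_ ?_
      · intro ω
        simp [stopAt]
      · intro ω
        rfl
    rw [e1, ← hstep]
    refine klDiv_map_eq P Q (measurable_stopAt _)
      (((measurable_pi_apply _).prodMk (measurable_stopAt _)).prodMk (measurable_pi_apply _))
      (fun ω => ((ω (Fin.castSucc ⟨k + 1, hk⟩), stopAt (k + 1) ω), ω (Fin.succ ⟨k + 1, hk⟩)))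
      (fun z i => if (i : ℕ) ≤ k + 1 then z.1.2 i else z.2)
      (((measurable_pi_apply _).prodMk (measurable_stopAt _)).prodMk (measurable_pi_apply _))
      ?_ ?_ ?_
    · refine measurable_pi_lambda _ fun i => ?_
      split_ifs <;> fun_prop
    · intro ω
      refine Prod.ext (Prod.ext ?_ ?_) ?_
      · simp [stopAt]
      · funext i
        simp only [stopAt]
        congr 1
        ext
        simp
      · simp only [stopAt]
        congr 1
        ext
        simp
    · intro ω
      funext i
      simp only [stopAt]
      split_ifs with h
      · congr 1
        ext
        simp
        omega
      · congr 1
        ext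
        simp
        omega

/-- Markov telescoping of KL divergence: if `P` and `Q` are Markov measures on
`X₀ × ⋯ × X_m`, `P ≪ Q`, and the one-dimensional marginals of `P` and `Q` agree at each
interior coordinate `j = 1, …, m−1`, then `KL(P‖Q) = Σ_{j=1}^m KL(P_{j−1,j}‖Q_{j−1,j})`. -/
theorem kl_markov_telescoping {X : Type*} [MeasurableSpace X] [StandardBorelSpace X]
    [Nonempty X] {m : ℕ} (hm : 0 < m)
    (P Q : Measure (Fin (m + 1) → X)) [IsProbabilityMeasure P] [IsProbabilityMeasure Q]
    (hPQ : P ≪ Q) (hP : IsMarkov P) (hQ : IsMarkov Q)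
    (hmarg : ∀ j : Fin (m + 1), 0 < (j : ℕ) → (j : ℕ) < m →
      P.map (fun ω => ω j) = Q.map (fun ω => ω j))
    (hint : Integrable (fun ω => Real.log (P.rnDeriv Q ω).toReal) P)
    (hint2 : ∀ j : Fin m, Integrable (fun z =>
      Real.log (((P.map fun ω => (ω j.castSucc, ω j.succ)).rnDeriv
        (Q.map fun ω => (ω j.castSucc, ω j.succ))) z).toReal)
      (P.map fun ω => (ω j.castSucc, ω j.succ))) :
    KL P Q = ∑ j : Fin m,
      KL (P.map fun ω => (ω j.castSucc, ω j.succ))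
        (Q.map fun ω => (ω j.castSucc, ω j.succ)) := by
  obtain ⟨k, rfl⟩ : ∃ k, m = k + 1 := ⟨m - 1, by omega⟩
  have hid : (stopAt (k + 1) : (Fin (k + 1 + 1) → X) → _) = id := by
    funext ω i
    simp only [stopAt, id]
    congr 1
    ext
    simp
    omega
  have hmain := klDiv_stopAt P Q hP hQ hmarg k (by omega)
  have hmeas : ∀ j : Fin (k + 1), Measurable
      (fun ω : Fin (k + 1 + 1) → X => (ω j.castSucc, ω j.succ)) := fun j => by fun_prop
  have hpP : ∀ j : Fin (k + 1), IsProbabilityMeasure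
      (P.map fun ω => (ω j.castSucc, ω j.succ)) :=
    fun j => Measure.isProbabilityMeasure_map (hmeas j).aemeasurable
  have hpQ : ∀ j : Fin (k + 1), IsProbabilityMeasure
      (Q.map fun ω => (ω j.castSucc, ω j.succ)) :=
    fun j => Measure.isProbabilityMeasure_map (hmeas j).aemeasurable
  rw [hid, Measure.map_id, Measure.map_id, Finset.sum_range] at hmain
  simp only [Fin.is_lt, dif_pos, Fin.eta] at hmain
  rw [kl_eq_toReal P Q hPQ, hmain, ENNReal.toReal_sum]
  · exact Finset.sum_congr rfl fun j _ => (kl_eq_toReal _ _ (hPQ.map (hmeas j))).symm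
  · exact fun j _ => InformationTheory.klDiv_ne_top (hPQ.map (hmeas j)) (hint2 j)
end

section
/- For a Markov chain decomposition: if P is a probability measure on X₀ × ⋯ × X_m that is the law of a Markov chain, then KL(P‖Q) = Σ_{j=1}^m KL(P_{j−1,j}‖Q_{j−1,j}) − Σ_{j=1}^{m−1} KL(P_j‖Q_j), whenever Q is also Markov (with the same coordinate ordering) and P ≪ Q with all divergences finite. -/
open MeasureTheory ProbabilityTheory

lemma rnDeriv_compProd_of_density {α β : Type*} [MeasurableSpace α] [MeasurableSpace β]
    (μ : Measure α) [IsFiniteMeasure μ] (κ η : Kernel α β) [IsFiniteKernel κ] [IsFiniteKernel η]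
    (f : α → β → ENNReal) (hf : Measurable (Function.uncurry f))
    (h : ∀ᵐ a ∂μ, κ a = (η a).withDensity (f a)) :
    (μ ⊗ₘ κ).rnDeriv (μ ⊗ₘ η) =ᵐ[μ ⊗ₘ η] fun p => f p.1 p.2 := by
  have : μ ⊗ₘ κ = (μ ⊗ₘ η).withDensity (fun p => f p.1 p.2) := by
    ext s hs
    rw [Measure.compProd_apply hs, withDensity_apply _ hs, ← lintegral_indicator hs,
      Measure.lintegral_compProd (Measurable.indicator (by exact hf) hs)]
    refine lintegral_congr_ae ?_
    filter_upwards [h] with a ha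
    rw [ha, withDensity_apply _ (measurable_prodMk_left hs),
      ← lintegral_indicator (measurable_prodMk_left hs)]
    rfl
  rw [this]
  exact Measure.rnDeriv_withDensity _ hf

lemma llr_comp_embedding {Ω α β : Type*} [MeasurableSpace Ω] [MeasurableSpace α]
    [MeasurableSpace β] (P Q : Measure Ω) [IsProbabilityMeasure P] [IsProbabilityMeasure Q]
    (hPQ : P ≪ Q) (S : Ω → α) (hS : Measurable S) (T : Ω → β) (e : α → β)
    (he : MeasurableEmbedding e) (hT : ∀ ω, T ω = e (S ω)) :
    ∀ᵐ ω ∂P, llr (P.map T) (Q.map T) (T ω) = llr (P.map S) (Q.map S) (S ω) := by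
  obtain rfl : T = e ∘ S := funext hT
  have := Measure.isProbabilityMeasure_map (μ := P) hS.aemeasurable
  have := Measure.isProbabilityMeasure_map (μ := Q) hS.aemeasurable
  have h := he.rnDeriv_map (P.map S) (Q.map S)
  rw [Measure.map_map he.measurable hS, Measure.map_map he.measurable hS] at h
  have h2 := hPQ.ae_le (ae_of_ae_map hS.aemeasurable h)
  filter_upwards [h2] with ω hω
  simp only [llr, Function.comp]
  rw [← hω]

lemma rnDeriv_toReal_pos_ae {α : Type*} [MeasurableSpace α] {μ ν : Measure α}
    [IsProbabilityMeasure μ] [IsProbabilityMeasure ν] (h : μ ≪ ν) :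
    ∀ᵐ x ∂μ, 0 < (μ.rnDeriv ν x).toReal := by
  filter_upwards [Measure.rnDeriv_pos h, h.ae_le (Measure.rnDeriv_ne_top μ ν)] with x h1 h2
  exact ENNReal.toReal_pos h1.ne' h2

lemma llr_markov_step {Ω γ β X : Type*} [MeasurableSpace Ω] [StandardBorelSpace Ω]
    [MeasurableSpace γ] [MeasurableSpace β] [StandardBorelSpace β] [Nonempty β]
    [MeasurableSpace X] [StandardBorelSpace X] [Nonempty X]
    (P Q : Measure Ω) [IsProbabilityMeasure P] [IsProbabilityMeasure Q] (hPQ : P ≪ Q)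
    (V : Ω → γ) (U : Ω → β) (W : Ω → X) (hV : Measurable V) (hU : Measurable U)
    (hW : Measurable W) (hP : U ⟂ᵢ[V, hV; P] W) (hQ : U ⟂ᵢ[V, hV; Q] W) :
    ∀ᵐ ω ∂P, llr (P.map fun ω => ((V ω, U ω), W ω)) (Q.map fun ω => ((V ω, U ω), W ω))
        ((V ω, U ω), W ω) =
      llr (P.map fun ω => (V ω, U ω)) (Q.map fun ω => (V ω, U ω)) (V ω, U ω)
      + (llr (P.map fun ω => (V ω, W ω)) (Q.map fun ω => (V ω, W ω)) (V ω, W ω)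
        - llr (P.map V) (Q.map V) (V ω)) := by
  rw [condIndepFun_iff_condDistrib_prod_ae_eq_prodMkRight hW hU hV] at hP hQ
  have eP := compProd_map_condDistrib (μ := P) (mβ := inferInstance) (X := fun ω => (V ω, U ω)) hW.aemeasurable
  have eQ := compProd_map_condDistrib (μ := Q) (mβ := inferInstance) (X := fun ω => (V ω, U ω)) hW.aemeasurable
  rw [Measure.compProd_congr hP] at eP
  rw [Measure.compProd_congr hQ] at eQ
  have fP := compProd_map_condDistrib (μ := P) (mβ := inferInstance) (X := V) hW.aemeasurable
  have fQ := compProd_map_condDistrib (μ := Q) (mβ := inferInstance) (X := V) hW.aemeasurable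
  have hVU : Measurable fun ω => (V ω, U ω) := hV.prodMk hU
  have hVW : Measurable fun ω => (V ω, W ω) := hV.prodMk hW
  have hVUW : Measurable fun ω => ((V ω, U ω), W ω) := hVU.prodMk hW
  have acVU := hPQ.map hVU
  have acVW := hPQ.map hVW
  have acVUW := hPQ.map hVUW
  have acV := hPQ.map hV
  have := Measure.isProbabilityMeasure_map (μ := P) hV.aemeasurable
  have := Measure.isProbabilityMeasure_map (μ := Q) hV.aemeasurable
  have := Measure.isProbabilityMeasure_map (μ := P) hVU.aemeasurable
  have := Measure.isProbabilityMeasure_map (μ := Q) hVU.aemeasurable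
  have := Measure.isProbabilityMeasure_map (μ := P) hVW.aemeasurable
  have := Measure.isProbabilityMeasure_map (μ := Q) hVW.aemeasurable
  have := Measure.isProbabilityMeasure_map (μ := P) hVUW.aemeasurable
  have := Measure.isProbabilityMeasure_map (μ := Q) hVUW.aemeasurable
  set κ := condDistrib W V P with hκ
  set η := condDistrib W V Q with hη
  have gVW : (P.map V) ⊗ₘ κ ≪ (P.map V) ⊗ₘ η :=
    Measure.absolutelyContinuous_compProd_of_compProd (by rw [fP, fQ]; exact acVW)
  have gVUW : (P.map fun ω => (V ω, U ω)) ⊗ₘ (κ.prodMkRight β) ≪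
      (P.map fun ω => (V ω, U ω)) ⊗ₘ (η.prodMkRight β) :=
    Measure.absolutelyContinuous_compProd_of_compProd (by rw [eP, eQ]; exact acVUW)
  have hden : ∀ᵐ v ∂(P.map V), κ v = (η v).withDensity (Kernel.rnDeriv κ η v) := by
    filter_upwards [Measure.absolutelyContinuous_compProd_right_iff.mp gVW] with v hv
    rw [← Kernel.withDensity_rnDeriv_eq hv, Kernel.withDensity_apply]
    exact Kernel.measurable_rnDeriv κ η
  have hden2 : ∀ᵐ p ∂(P.map fun ω => (V ω, U ω)), κ.prodMkRight β p =
      (η.prodMkRight β p).withDensity (Kernel.rnDeriv κ η p.1) := by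
    have hfst : P.map V = (P.map fun ω => (V ω, U ω)).map Prod.fst := by
      rw [Measure.map_map measurable_fst hVU]; rfl
    rw [hfst] at hden
    filter_upwards [ae_of_ae_map measurable_fst.aemeasurable hden] with p hp
    simpa [Kernel.prodMkRight_apply] using hp
  have a1 := rnDeriv_compProd_of_density _ κ η _ (Kernel.measurable_rnDeriv κ η) hden
  have a2 := rnDeriv_compProd_of_density _ (κ.prodMkRight β) (η.prodMkRight β)
    (fun p x => Kernel.rnDeriv κ η p.1 x)
    ((Kernel.measurable_rnDeriv κ η).comp
      ((measurable_fst.comp measurable_fst).prodMk measurable_snd)) hden2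
  have b1 := rnDeriv_compProd gVW (Q.map V)
  have b2 := rnDeriv_compProd gVUW (Q.map fun ω => (V ω, U ω))
  replace a1 := gVW.ae_le a1
  replace a2 := gVUW.ae_le a2
  rw [fP] at a1 b1
  rw [fQ] at b1
  rw [eP] at a2 b2
  rw [eQ] at b2
  replace b1 := acVW.ae_le b1
  replace b2 := acVUW.ae_le b2
  replace a1 := ae_of_ae_map hVW.aemeasurable a1
  replace b1 := ae_of_ae_map hVW.aemeasurable b1
  replace a2 := ae_of_ae_map hVUW.aemeasurable a2
  replace b2 := ae_of_ae_map hVUW.aemeasurable b2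
  have c1 := ae_of_ae_map hVW.aemeasurable  (rnDeriv_toReal_pos_ae acVW)
  have c2 := ae_of_ae_map hVUW.aemeasurable  (rnDeriv_toReal_pos_ae acVUW)
  filter_upwards [a1, a2, b1, b2, c1, c2] with ω a1 a2 b1 b2 c1 c2
  simp only [llr]
  rw [b1, a1, ENNReal.toReal_mul] at c1
  rw [b2, a2, ENNReal.toReal_mul] at c2
  rw [b1, b2, a1, a2, ENNReal.toReal_mul, ENNReal.toReal_mul]
  rw [Real.log_mul (left_ne_zero_of_mul c1.ne') (right_ne_zero_of_mul c1.ne'),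
    Real.log_mul (left_ne_zero_of_mul c2.ne') (right_ne_zero_of_mul c2.ne')]
  ring

/-- The first `k + 1` coordinates. -/
def initSegMap (X : Type*) (m k : ℕ) (hk : k ≤ m) (ω : Fin (m + 1) → X) : Fin (k + 1) → X :=
  fun i => ω (Fin.castLE (by omega) i)

lemma measurable_initSegMap (X : Type*) [MeasurableSpace X] (m k : ℕ) (hk : k ≤ m) :
    Measurable (initSegMap X m k hk) :=
  measurable_pi_lambda _ fun _ => measurable_pi_apply _

lemma IsMarkov.condIndepFun_initSeg {X : Type*} [mX : MeasurableSpace X] [StandardBorelSpace X]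
    [Nonempty X] {m : ℕ} (P : Measure (Fin (m + 1) → X)) [IsFiniteMeasure P] (hP : IsMarkov P)
    (k : ℕ) (hk : k + 1 ≤ m) :
    initSegMap X m k (by omega) ⟂ᵢ[fun ω => ω (Fin.castSucc ⟨k, hk⟩),
      measurable_pi_apply _; P] (fun ω => ω (Fin.succ ⟨k, hk⟩)) := by
  rw [condIndepFun_iff_condIndep]
  refine condIndep_of_condIndep_of_le_left (condIndep_of_condIndep_of_le_right (hP _) ?_) ?_
  · exact le_iSup₂_of_le (Fin.succ ⟨k, hk⟩)
      (by simp [Fin.le_def]) le_rfl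
  · simp only [MeasurableSpace.pi, MeasurableSpace.comap_iSup, MeasurableSpace.comap_comp]
    refine iSup_le fun i => ?_
    exact le_iSup₂_of_le (Fin.castLE (by omega) i)
      (by simp [Fin.le_def]; omega) le_rfl

lemma llr_initSeg {X : Type*} [MeasurableSpace X] [StandardBorelSpace X]
    [Nonempty X] {m : ℕ}
    (P Q : Measure (Fin (m + 1) → X)) [IsProbabilityMeasure P] [IsProbabilityMeasure Q]
    (hPQ : P ≪ Q) (hP : IsMarkov P) (hQ : IsMarkov Q) (k : ℕ) (hk : k ≤ m) :
    ∀ᵐ ω ∂P, llr (P.map (initSegMap X m k hk)) (Q.map (initSegMap X m k hk)) (initSegMap X m k hk ω) =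
      llr (P.map fun ω => ω 0) (Q.map fun ω => ω 0) (ω 0) +
      ∑ i : Fin k, (llr (P.map fun ω => (ω (Fin.castLE hk i).castSucc, ω (Fin.castLE hk i).succ))
        (Q.map fun ω => (ω (Fin.castLE hk i).castSucc, ω (Fin.castLE hk i).succ))
        (ω (Fin.castLE hk i).castSucc, ω (Fin.castLE hk i).succ)
        - llr (P.map fun ω => ω (Fin.castLE hk i).castSucc)
          (Q.map fun ω => ω (Fin.castLE hk i).castSucc) (ω (Fin.castLE hk i).castSucc)) := by
  induction k with
  | zero =>
    have he : MeasurableEmbedding (fun (y : Fin 1 → X) => y 0) :=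
      (measurable_pi_apply 0).measurableEmbedding (fun a b h => by
        funext i; rw [Subsingleton.elim i 0]; exact h)
    filter_upwards [llr_comp_embedding P Q hPQ (initSegMap X m 0 hk)
      (measurable_initSegMap X m 0 hk) (fun ω => ω 0) _ he (fun ω => rfl)] with ω hω
    simp [hω]
  | succ k ih =>
    have h1 := llr_markov_step P Q hPQ _ _ _ (measurable_pi_apply _)
      (measurable_initSegMap X m k (by omega)) (measurable_pi_apply _)
      (hP.condIndepFun_initSeg P k hk) (hQ.condIndepFun_initSeg Q k hk)
    have he1 : MeasurableEmbedding (fun (y : Fin (k + 1) → X) => (y (Fin.last k), y)) :=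
      Measurable.measurableEmbedding (by fun_prop) (fun a b h => (Prod.ext_iff.mp h).2)
    have he2 : MeasurableEmbedding (fun (y : Fin (k + 2) → X) =>
        ((y (Fin.last k).castSucc, fun i : Fin (k + 1) => y i.castSucc), y (Fin.last (k + 1)))) :=
      Measurable.measurableEmbedding (by fun_prop) (fun a b h => by
        simp only [Prod.mk.injEq] at h
        funext i
        refine Fin.lastCases h.2 (fun i => congrFun h.1.2 i) i)
    have h2 := llr_comp_embedding P Q hPQ (initSegMap X m k (by omega))
      (measurable_initSegMap X m k (by omega))
      (fun ω => (ω (Fin.castSucc ⟨k, hk⟩), initSegMap X m k (by omega) ω)) _ he1 (fun ω => rfl)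
    have h3 := llr_comp_embedding P Q hPQ (initSegMap X m (k + 1) hk)
      (measurable_initSegMap X m (k + 1) hk)
      (fun ω => ((ω (Fin.castSucc ⟨k, hk⟩), initSegMap X m k (by omega) ω),
        ω (Fin.succ ⟨k, hk⟩))) _ he2 (fun ω => rfl)
    filter_upwards [ih (by omega), h1, h2, h3] with ω ih h1 h2 h3
    rw [Fin.sum_univ_castSucc, ← add_assoc, ← h3, h1, h2, ih]
    rfl

lemma kl_markov_aux {X : Type*} [MeasurableSpace X] [StandardBorelSpace X]
    [Nonempty X] {m : ℕ}
    (P Q : Measure (Fin (m + 1) → X)) [IsProbabilityMeasure P] [IsProbabilityMeasure Q]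
    (hPQ : P ≪ Q) (hP : IsMarkov P) (hQ : IsMarkov Q)
    (hint2 : ∀ j : Fin m, Integrable (fun z =>
      Real.log (((P.map fun ω => (ω j.castSucc, ω j.succ)).rnDeriv
        (Q.map fun ω => (ω j.castSucc, ω j.succ))) z).toReal)
      (P.map fun ω => (ω j.castSucc, ω j.succ)))
    (hint1 : ∀ j : Fin (m + 1), Integrable (fun x =>
      Real.log (((P.map fun ω => ω j).rnDeriv (Q.map fun ω => ω j)) x).toReal)
      (P.map fun ω => ω j)) :
    KL P Q = KL (P.map fun ω => ω 0) (Q.map fun ω => ω 0) +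
      ∑ j : Fin m, (KL (P.map fun ω => (ω j.castSucc, ω j.succ))
          (Q.map fun ω => (ω j.castSucc, ω j.succ)) -
        KL (P.map fun ω => ω j.castSucc) (Q.map fun ω => ω j.castSucc)) := by
  have key := llr_initSeg P Q hPQ hP hQ m le_rfl
  have hid : initSegMap X m m le_rfl = id := by funext ω i; rfl
  rw [hid, Measure.map_id, Measure.map_id] at key
  simp only [id_eq, Fin.castLE_rfl] at key
  have m1 : ∀ j : Fin (m + 1), AEMeasurable (fun ω : Fin (m + 1) → X => ω j) P :=
    fun j => (measurable_pi_apply j).aemeasurable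
  have m2 : ∀ j : Fin m, AEMeasurable (fun ω : Fin (m + 1) → X => (ω j.castSucc, ω j.succ)) P :=
    fun j => ((measurable_pi_apply _).prodMk (measurable_pi_apply _)).aemeasurable
  have i1 : ∀ j : Fin (m + 1), Integrable (fun ω =>
      llr (P.map fun ω => ω j) (Q.map fun ω => ω j) (ω j)) P :=
    fun j => (hint1 j).comp_aemeasurable (m1 j)
  have i2 : ∀ j : Fin m, Integrable (fun ω =>
      llr (P.map fun ω => (ω j.castSucc, ω j.succ)) (Q.map fun ω => (ω j.castSucc, ω j.succ))
        (ω j.castSucc, ω j.succ)) P :=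
    fun j => (hint2 j).comp_aemeasurable (m2 j)
  have i3 : ∀ j : Fin m, Integrable (fun ω =>
      llr (P.map fun ω => (ω j.castSucc, ω j.succ)) (Q.map fun ω => (ω j.castSucc, ω j.succ))
        (ω j.castSucc, ω j.succ) -
      llr (P.map fun ω => ω j.castSucc) (Q.map fun ω => ω j.castSucc) (ω j.castSucc)) P :=
    fun j => (i2 j).sub (i1 _)
  have k1 : ∀ j : Fin (m + 1), KL (P.map fun ω => ω j) (Q.map fun ω => ω j) =
      ∫ ω, llr (P.map fun ω => ω j) (Q.map fun ω => ω j) (ω j) ∂P :=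
    fun j => integral_map (m1 j) (hint1 j).aestronglyMeasurable
  have k2 : ∀ j : Fin m, KL (P.map fun ω => (ω j.castSucc, ω j.succ))
      (Q.map fun ω => (ω j.castSucc, ω j.succ)) =
      ∫ ω, llr (P.map fun ω => (ω j.castSucc, ω j.succ))
        (Q.map fun ω => (ω j.castSucc, ω j.succ)) (ω j.castSucc, ω j.succ) ∂P :=
    fun j => integral_map (m2 j) (hint2 j).aestronglyMeasurable
  have : KL P Q = ∫ ω, llr P Q ω ∂P := rfl
  rw [this, integral_congr_ae key, integral_add (i1 0)
    (integrable_finsetSum _ fun j _ => i3 j),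
    integral_finsetSum _ fun j _ => i3 j]
  congr 1
  · exact (k1 0).symm
  · refine Finset.sum_congr rfl fun j _ => ?_
    rw [k1, k2]
    exact integral_sub (i2 j) (i1 _)

/-- Markov chain decomposition of KL divergence: if `P` and `Q` are Markov measures on
`X₀ × ⋯ × X_m` with `P ≪ Q` and all divergences finite, then
`KL(P‖Q) = Σ_{j=1}^m KL(P_{j−1,j}‖Q_{j−1,j}) − Σ_{j=1}^{m−1} KL(P_j‖Q_j)`. -/
theorem kl_markov_decomposition {X : Type*} [MeasurableSpace X] [StandardBorelSpace X]
    [Nonempty X] {m : ℕ} (hm : 0 < m)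
    (P Q : Measure (Fin (m + 1) → X)) [IsProbabilityMeasure P] [IsProbabilityMeasure Q]
    (hPQ : P ≪ Q) (hP : IsMarkov P) (hQ : IsMarkov Q)
    (hint : Integrable (fun ω => Real.log (P.rnDeriv Q ω).toReal) P)
    (hint2 : ∀ j : Fin m, Integrable (fun z =>
      Real.log (((P.map fun ω => (ω j.castSucc, ω j.succ)).rnDeriv
        (Q.map fun ω => (ω j.castSucc, ω j.succ))) z).toReal)
      (P.map fun ω => (ω j.castSucc, ω j.succ)))
    (hint1 : ∀ j : Fin (m + 1), Integrable (fun x =>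
      Real.log (((P.map fun ω => ω j).rnDeriv (Q.map fun ω => ω j)) x).toReal)
      (P.map fun ω => ω j)) :
    KL P Q = (∑ j : Fin m,
        KL (P.map fun ω => (ω j.castSucc, ω j.succ))
          (Q.map fun ω => (ω j.castSucc, ω j.succ)))
      - ∑ j ∈ Finset.univ.filter (fun j : Fin (m + 1) => 0 < (j : ℕ) ∧ (j : ℕ) < m),
          KL (P.map fun ω => ω j) (Q.map fun ω => ω j) := by
  have h1 := kl_markov_aux P Q hPQ hP hQ hint2 hint1
  rw [h1, Finset.sum_sub_distrib]
  obtain ⟨n, rfl⟩ : ∃ n, m = n + 1 := ⟨m - 1, by omega⟩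
  have hs : ∀ F : Fin (n + 1 + 1) → ℝ, ∑ j ∈ Finset.univ.filter
      (fun j : Fin (n + 1 + 1) => 0 < (j : ℕ) ∧ (j : ℕ) < n + 1), F j =
      ∑ j : Fin n, F j.succ.castSucc := by
    intro F
    rw [Finset.sum_filter, Fin.sum_univ_castSucc, Fin.sum_univ_succ]
    simp
  rw [hs (fun j => KL (P.map fun ω => ω j) (Q.map fun ω => ω j)), Fin.sum_univ_succ
    (fun j : Fin (n + 1) => KL (P.map fun ω => ω j.castSucc) (Q.map fun ω => ω j.castSucc))]
  simp only [Fin.castSucc_zero]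
  ring
end
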